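/- If A carries a conjugate-linear antimultiplicative involution ⋆ with M̄_α̇^β̇ = (M_α^β)^⋆ for all α, β, then the Lorentz generators are real: (Λ_L^K)^⋆ = Λ_L^K for all L, K ∈ {0,1,2,3}. -/

import Mathlib

noncomputable section

open scoped Matrix

/-- Lower undotted spinor metric `ε_{αβ}` of the two-parameter deformation. -/
def epsLo (q r : ℝ) : Matrix (Fin 2) (Fin 2) ℂ :=
  ((Real.sqrt (1 - r ^ 2) : ℂ))⁻¹ •
    !![Complex.I * (r : ℂ), -((Real.sqrt q : ℂ))⁻¹; (Real.sqrt q : ℂ), Complex.I * (r : ℂ)]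

/-- Upper undotted spinor metric `ε^{αβ}`. -/
def epsUp (q r : ℝ) : Matrix (Fin 2) (Fin 2) ℂ :=
  ((Real.sqrt (1 - r ^ 2) : ℂ))⁻¹ •
    !![Complex.I * (r : ℂ), ((Real.sqrt q : ℂ))⁻¹; -(Real.sqrt q : ℂ), Complex.I * (r : ℂ)]

/-- Lower dotted spinor metric `ε_{α̇β̇}`. -/
def epsLoD (q r : ℝ) : Matrix (Fin 2) (Fin 2) ℂ :=
  ((Real.sqrt (1 - r ^ 2) : ℂ))⁻¹ •
    !![-(Complex.I * (r : ℂ)), (Real.sqrt q : ℂ); -((Real.sqrt q : ℂ))⁻¹, -(Complex.I * (r : ℂ))]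

/-- Upper dotted spinor metric `ε^{α̇β̇}`. -/
def epsUpD (q r : ℝ) : Matrix (Fin 2) (Fin 2) ℂ :=
  ((Real.sqrt (1 - r ^ 2) : ℂ))⁻¹ •
    !![-(Complex.I * (r : ℂ)), -(Real.sqrt q : ℂ); ((Real.sqrt q : ℂ))⁻¹, -(Complex.I * (r : ℂ))]

/-- `Q = (2r + q + q⁻¹)/(1 − r²)`. -/
def Qval (q r : ℝ) : ℝ := (2 * r + q + q⁻¹) / (1 - r ^ 2)

/-- The R-matrix `R^{αβ}_{γδ} = δ^α_γ δ^β_δ + c · ε^{αβ} ε_{γδ}` (with `c = a^{±1}`). -/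
def Rm (q r : ℝ) (c : ℂ) (α β γ δ : Fin 2) : ℂ :=
  (if α = γ then 1 else 0) * (if β = δ then 1 else 0) + c * epsUp q r α β * epsLo q r γ δ

/-- The conjugate `σ̄_±^{α̇β} = a^{±1/2} Σ ε^{α̇λ̇} ε_{ρκ} R^{∓σκ}_{μν} ε^{μλ} ε^{νβ} σ_{σρ̇}`
of a 2×2 matrix `σ`; `s = true` is the `+` sign, `s = false` the `−` sign. -/
def sbar (q r a : ℝ) (s : Bool) (σ : Matrix (Fin 2) (Fin 2) ℂ) (ad b : Fin 2) : ℂ :=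
  (if s then (Real.sqrt a : ℂ) else ((Real.sqrt a : ℂ))⁻¹) *
    ∑ l, ∑ sg, ∑ rh, ∑ ka, ∑ mu, ∑ nu,
      epsUpD q r ad l * epsLo q r rh ka * Rm q r (if s then ((a : ℂ))⁻¹ else (a : ℂ)) sg ka mu nu *
        epsUp q r mu l * epsUp q r nu b * σ sg rh

/-- The quantum Pauli matrices `σ^0, σ^1, σ^2, σ^3`. -/
def pauli : Fin 4 → Matrix (Fin 2) (Fin 2) ℂ :=
  ![!![1, 0; 0, 1], !![0, 1; 1, 0], !![0, -Complex.I; Complex.I, 0], !![1, 0; 0, -1]]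

/-- The metric pairing `G_±^{IJ} = (1/Q) Σ ε^{αν} σ^I_{αβ̇} σ̄_±^{Jβ̇γ} ε_{γν}`. -/
def Gpair (q r a : ℝ) (s : Bool) (σI σJ : Matrix (Fin 2) (Fin 2) ℂ) : ℂ :=
  (1 / (Qval q r : ℂ)) * ∑ al, ∑ nu, ∑ be, ∑ ga,
    epsUp q r al nu * σI al be * sbar q r a s σJ be ga * epsLo q r ga nu

/-- The quantum Minkowski metric `G_±^{IJ}` as a 4×4 matrix. -/
def GupM (q r a : ℝ) (s : Bool) : Matrix (Fin 4) (Fin 4) ℂ :=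
  fun I J => Gpair q r a s (pauli I) (pauli J)

/-- The inverse metric `G_{±IJ}`. -/
def GloM (q r a : ℝ) (s : Bool) : Matrix (Fin 4) (Fin 4) ℂ := (GupM q r a s)⁻¹

/-- The lowered conjugate Pauli matrices `σ̄_L^{α̇β} = Σ_N G_{+LN} σ̄_+^{Nα̇β}`. -/
def sbarL (q r a : ℝ) (L : Fin 4) (ad b : Fin 2) : ℂ :=
  ∑ N, GloM q r a true L N * sbar q r a true (pauli N) ad b

/-- The quantum Lorentz group generators
`Λ_L^K = (1/Q) Σ ε_{γ̇δ̇} σ̄_L^{δ̇α} M_α^σ σ^K_{σρ̇} M̄_β̇^{ρ̇} ε^{γ̇β̇}`. -/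
def Lor {A : Type*} [Ring A] [Algebra ℂ A] (q r a : ℝ)
    (M Mb : Fin 2 → Fin 2 → A) (L K : Fin 4) : A :=
  ∑ ga, ∑ de, ∑ al, ∑ sg, ∑ rh, ∑ be,
    ((1 / (Qval q r : ℂ)) * epsLoD q r ga de * sbarL q r a L de al * pauli K sg rh *
      epsUpD q r ga be) • (M al sg * Mb be rh)

/-- The Lorentz R-matrices
`𝓡^{±NM}_{LK} = (1/Q²) Σ R^{∓ακ}_{τσ} R^{∓μβ}_{κν} R^{±ρξ}_{δα} R^{±λγ}_{ξμ}
σ^{M β̇}_γ σ^{N λ̇}_ρ σ̄_{Lτ̇}^δ σ̄_{Kν̇}^σ`. -/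
def Rlor (q r a : ℝ) (s : Bool) (N M L K : Fin 4) : ℂ :=
  (1 / (Qval q r : ℂ) ^ 2) *
    ∑ al, ∑ be, ∑ ga, ∑ de, ∑ ka, ∑ l, ∑ mu, ∑ nu, ∑ xi, ∑ rh, ∑ sg, ∑ ta,
      Rm q r (if s then ((a : ℂ))⁻¹ else (a : ℂ)) al ka ta sg *
        Rm q r (if s then ((a : ℂ))⁻¹ else (a : ℂ)) mu be ka nu *
          Rm q r (if s then (a : ℂ) else ((a : ℂ))⁻¹) rh xi de al *
            Rm q r (if s then (a : ℂ) else ((a : ℂ))⁻¹) l ga xi mu *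
              (∑ p, epsUpD q r be p * pauli M ga p) *
                (∑ p, epsUpD q r l p * pauli N rh p) *
                  (∑ p, epsLoD q r ta p * sbarL q r a L p de) *
                    (∑ p, epsLoD q r nu p * sbarL q r a K p sg)

end

section

open scoped Matrix

/-- The twist `ε_{αν} ε^{γν}` by which the quantum trace differs from the ordinary one. -/
noncomputable def epsTwist (q r : ℝ) : Matrix (Fin 2) (Fin 2) ℂ := epsLo q r * (epsUp q r)ᵀ

theorem ofReal_sqrt_one_sub_sq_mul_self {r : ℝ} (hr : r ^ 2 < 1) :
    (Real.sqrt (1 - r ^ 2) : ℂ) * (Real.sqrt (1 - r ^ 2) : ℂ) = 1 - (r : ℂ) ^ 2 := by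
  rw [← Complex.ofReal_mul, Real.mul_self_sqrt (by linarith)]
  push_cast
  rfl

theorem ofReal_sqrt_ne_zero {x : ℝ} (hx : 0 < x) : (Real.sqrt x : ℂ) ≠ 0 :=
  Complex.ofReal_ne_zero.mpr (Real.sqrt_pos.mpr hx).ne'

theorem epsLo_mul_epsUp {q r : ℝ} (hq : 0 < q) (hr : r ^ 2 < 1) :
    epsLo q r * epsUp q r = 1 := by
  have hu := ofReal_sqrt_ne_zero hq
  have hv := ofReal_sqrt_ne_zero (sub_pos.mpr hr)
  have hvv := ofReal_sqrt_one_sub_sq_mul_self hr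
  ext i j
  fin_cases i <;> fin_cases j <;>
    simp [epsLo, epsUp, Matrix.mul_apply, Fin.sum_univ_two] <;> field_simp <;>
    first
    | ring1
    | linear_combination -hvv + (r : ℂ) ^ 2 * Complex.I_sq

theorem epsUpD_mul_transpose_epsUp {q r : ℝ} (hq : 0 < q) (hr : r ^ 2 < 1) :
    epsUpD q r * (epsUp q r)ᵀ = -1 := by
  have hu := ofReal_sqrt_ne_zero hq
  have hv := ofReal_sqrt_ne_zero (sub_pos.mpr hr)
  have hvv := ofReal_sqrt_one_sub_sq_mul_self hr
  ext i j
  fin_cases i <;> fin_cases j <;>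
    simp [epsUpD, epsUp, Matrix.mul_apply, Fin.sum_univ_two] <;> field_simp <;>
    first
    | ring1
    | linear_combination hvv - (r : ℂ) ^ 2 * Complex.I_sq

theorem transpose_epsUpD_mul_epsLoD (q r : ℝ) :
    (epsUpD q r)ᵀ * epsLoD q r = epsTwist q r := by
  ext i j
  fin_cases i <;> fin_cases j <;>
    simp [epsTwist, epsUpD, epsUp, epsLo, epsLoD, Matrix.mul_apply, Fin.sum_univ_two]

theorem sbar_true_eq {q r : ℝ} (hq : 0 < q) (hr : r ^ 2 < 1) (a : ℝ)
    (σ : Matrix (Fin 2) (Fin 2) ℂ) :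
    Matrix.of (sbar q r a true σ) =
      -(Real.sqrt a : ℂ) • (σ + ((a : ℂ)⁻¹ * (σ * epsTwist q r).trace) • 1) := by
  have key : Matrix.of (sbar q r a true σ) = (Real.sqrt a : ℂ) •
      (epsUpD q r * (epsUp q r)ᵀ * σ * (epsLo q r * epsUp q r) +
        ((a : ℂ)⁻¹ * (σ * epsTwist q r).trace) •
          (epsUpD q r * (epsUp q r)ᵀ * (epsLo q r * epsUp q r))) := by
    ext i j
    simp only [Matrix.of_apply, sbar, if_true, Rm, epsTwist, Matrix.smul_apply, Matrix.add_apply,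
      smul_eq_mul]
    congr 1
    generalize epsUpD q r = D
    generalize epsUp q r = U
    generalize epsLo q r = L
    simp only [Matrix.mul_apply, Matrix.trace_fin_two, Matrix.transpose_apply, Fin.sum_univ_two]
    simp
    ring
  rw [key, epsUpD_mul_transpose_epsUp hq hr, epsLo_mul_epsUp hq hr]
  simp only [mul_one, neg_mul, one_mul, smul_neg, neg_smul, smul_add]

theorem trace_mul_sbar_true_mul_epsTwist {q r : ℝ} (hq : 0 < q) (hr : r ^ 2 < 1) (a : ℝ)
    (σ τ : Matrix (Fin 2) (Fin 2) ℂ) :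
    (σ * Matrix.of (sbar q r a true τ) * epsTwist q r).trace =
      (τ * (epsTwist q r * Matrix.of (sbar q r a true σ))).trace := by
  rw [sbar_true_eq hq hr, sbar_true_eq hq hr]
  simp only [mul_add, add_mul, Matrix.mul_smul, Matrix.smul_mul, Matrix.trace_smul,
    Matrix.trace_add, mul_one, smul_eq_mul]
  rw [← Matrix.mul_assoc τ, Matrix.trace_mul_comm (τ * epsTwist q r) σ, Matrix.mul_assoc σ]
  ring

theorem Gpair_eq_trace (q r a : ℝ) (s : Bool) (σ τ : Matrix (Fin 2) (Fin 2) ℂ) :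
    Gpair q r a s σ τ =
      (1 / (Qval q r : ℂ)) * (σ * Matrix.of (sbar q r a s τ) * epsTwist q r).trace := by
  simp only [Gpair, epsTwist, Matrix.trace_fin_two, Matrix.mul_apply, Matrix.of_apply,
    Matrix.transpose_apply, Fin.sum_univ_two]
  ring

theorem eq_smul_pauli_of_trace_pauli_mul {X : Matrix (Fin 2) (Fin 2) ℂ} {c : ℂ} {L : Fin 4}
    (h : ∀ I, (pauli I * X).trace = if L = I then c else 0) : X = (c / 2) • pauli L := by
  have h0 := h 0
  have h1 := h 1
  have h2 := h 2
  have h3 := h 3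
  have hI := Complex.I_sq
  simp only [pauli, Matrix.trace_fin_two, Matrix.mul_apply, Fin.sum_univ_two] at h0 h1 h2 h3
  ext i j
  fin_cases L <;> simp at h0 h1 h2 h3 <;> fin_cases i <;> fin_cases j <;> simp [pauli] <;>
    first
    | linear_combination (h0 + h3) / 2
    | linear_combination (h0 - h3) / 2
    | linear_combination (h1 - Complex.I * h2) / 2 + (X 0 1 - X 1 0) / 2 * hI
    | linear_combination (h1 + Complex.I * h2) / 2 + (X 1 0 - X 0 1) / 2 * hI

theorem trace_pauli_mul_sbarL {q r a : ℝ} (hq : 0 < q) (hr : r ^ 2 < 1) (hQ : (Qval q r : ℂ) ≠ 0)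
    (hG : IsUnit (GupM q r a true).det) (L I : Fin 4) :
    (pauli I * (epsTwist q r * Matrix.of (sbarL q r a L))).trace =
      if L = I then (Qval q r : ℂ) else 0 := by
  have hsum : Matrix.of (sbarL q r a L) =
      ∑ N, GloM q r a true L N • Matrix.of (sbar q r a true (pauli N)) := by
    ext i j
    simp [sbarL, Matrix.sum_apply]
  have hinv : (GloM q r a true * GupM q r a true) L I = (1 : Matrix (Fin 4) (Fin 4) ℂ) L I := by
    rw [GloM, Matrix.nonsing_inv_mul _ hG]
  rw [Matrix.mul_apply, Matrix.one_apply] at hinv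
  simp only [GupM, Gpair_eq_trace, trace_mul_sbar_true_mul_epsTwist hq hr] at hinv
  rw [hsum]
  simp only [Finset.mul_sum, Matrix.mul_smul, Matrix.trace_sum, Matrix.trace_smul, smul_eq_mul]
  calc _ = (Qval q r : ℂ) * ∑ N, GloM q r a true L N * (1 / (Qval q r : ℂ) *
        (pauli I * (epsTwist q r * Matrix.of (sbar q r a true (pauli N)))).trace) := by
        rw [Finset.mul_sum]
        refine Finset.sum_congr rfl fun N _ => ?_
        field_simp
    _ = _ := by rw [hinv, mul_ite, mul_one, mul_zero]

theorem epsTwist_mul_sbarL {q r a : ℝ} (hq : 0 < q) (hr : r ^ 2 < 1) (hQ : (Qval q r : ℂ) ≠ 0)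
    (hG : IsUnit (GupM q r a true).det) (L : Fin 4) :
    epsTwist q r * Matrix.of (sbarL q r a L) = ((Qval q r : ℂ) / 2) • pauli L :=
  eq_smul_pauli_of_trace_pauli_mul (trace_pauli_mul_sbarL hq hr hQ hG L)

theorem star_pauli_apply (L : Fin 4) (i j : Fin 2) : star (pauli L i j) = pauli L j i := by
  fin_cases L <;> fin_cases i <;> fin_cases j <;> simp [pauli]

theorem Lor_eq_sum_pauli {q r a : ℝ} (hq : 0 < q) (hr : r ^ 2 < 1) (hQ : (Qval q r : ℂ) ≠ 0)
    (hG : IsUnit (GupM q r a true).det) {A : Type*} [Ring A] [Algebra ℂ A]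
    (M Mb : Fin 2 → Fin 2 → A) (L K : Fin 4) :
    Lor q r a M Mb L K = ∑ α, ∑ β, ∑ σ, ∑ ρ,
      ((1 / 2 : ℂ) * (pauli L β α * pauli K σ ρ)) • (M α σ * Mb β ρ) := by
  have hC : ∀ α β, ∑ γ, ∑ δ, epsLoD q r γ δ * sbarL q r a L δ α * epsUpD q r γ β =
      (Qval q r : ℂ) / 2 * pauli L β α := by
    intro α β
    have h := congrFun (congrFun (epsTwist_mul_sbarL hq hr hQ hG L) β) α
    rw [← transpose_epsUpD_mul_epsLoD, Matrix.smul_apply, smul_eq_mul] at h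
    rw [← h]
    simp only [Matrix.mul_apply, Matrix.transpose_apply, Matrix.of_apply, Fin.sum_univ_two]
    ring
  calc Lor q r a M Mb L K = ∑ α, ∑ β, ∑ σ, ∑ ρ, (1 / (Qval q r : ℂ) *
        (∑ γ, ∑ δ, epsLoD q r γ δ * sbarL q r a L δ α * epsUpD q r γ β) * pauli K σ ρ) •
          (M α σ * Mb β ρ) := by
        simp only [Lor, Fin.sum_univ_two]
        module
    _ = _ := by
        simp only [hC]
        refine Finset.sum_congr rfl fun α _ => Finset.sum_congr rfl fun β _ =>
          Finset.sum_congr rfl fun σ _ => Finset.sum_congr rfl fun ρ _ => ?_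
        congr 1
        field_simp

end

/-- if `A` carries a conjugate-linear antimultiplicative involution
`⋆` with `M̄_α̇^β̇ = (M_α^β)^⋆`, then the Lorentz generators are real:
`(Λ_L^K)^⋆ = Λ_L^K`. -/
theorem lorentz_real (q r : ℝ) (hq : 0 < q) (hr : r ^ 2 < 1)
    (a : ℝ) (ha : 0 < a) (haQ : a + a⁻¹ = Qval q r)
    (hG : ∀ s, IsUnit (GupM q r a s).det)
    {A : Type*} [Ring A] [Algebra ℂ A] [StarRing A] [StarModule ℂ A]
    (M Mb : Fin 2 → Fin 2 → A)
    (hstar : ∀ α β : Fin 2, Mb α β = star (M α β))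
    (hu1 : ∀ γ δ : Fin 2,
      ∑ α, ∑ β, epsLo q r α β • (M γ α * M δ β) = epsLo q r γ δ • (1 : A))
    (hu2 : ∀ α β : Fin 2,
      ∑ γ, ∑ δ, epsUp q r γ δ • (M γ α * M δ β) = epsUp q r α β • (1 : A))
    (hu3 : ∀ γ δ : Fin 2,
      ∑ α, ∑ β, epsLoD q r α β • (Mb γ α * Mb δ β) = epsLoD q r γ δ • (1 : A))
    (hu4 : ∀ α β : Fin 2,
      ∑ γ, ∑ δ, epsUpD q r γ δ • (Mb γ α * Mb δ β) = epsUpD q r α β • (1 : A))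
    (hmix : ∀ c : ℂ, (c = (a : ℂ) ∨ c = ((a : ℂ))⁻¹) →
      ∀ α σ ρ β : Fin 2,
        ∑ γ, ∑ δ, Rm q r c β δ ρ γ • (M α γ * Mb σ δ) =
          ∑ γ, ∑ δ, Rm q r c γ σ δ α • (Mb δ ρ * M γ β)) :
    ∀ L K : Fin 4, star (Lor q r a M Mb L K) = Lor q r a M Mb L K := by
  intro L K
  have hQ : (Qval q r : ℂ) ≠ 0 := by
    rw [← haQ]
    exact Complex.ofReal_ne_zero.mpr (add_pos ha (inv_pos.mpr ha)).ne'
  rw [Lor_eq_sum_pauli hq hr hQ (hG true)]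
  simp only [star_sum, star_smul, star_mul, hstar, star_star, star_pauli_apply]
  rw [Finset.sum_comm]
  refine Finset.sum_congr rfl fun α _ => Finset.sum_congr rfl fun β _ => ?_
  rw [Finset.sum_comm]
  refine Finset.sum_congr rfl fun σ _ => Finset.sum_congr rfl fun ρ _ => ?_
  congr 1
  simp
  ring
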